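/- arXiv:2007.01218 — 3 statements merged into one kernel-verified Lean document; each statement's English description precedes it below -/
import Mathlib

section
/- (Completeness of the Koopman modes at t = 0.) Let u₀ ∈ ω_B. Then for every x ∈ [0,1], the family (φ_ν(u₀) a_ν(x))_{ν ∈ 𝒜} is absolutely summable and Σ_{ν ∈ 𝒜} φ_ν(u₀) a_ν(x) = u₀(x). -/
open MeasureTheory Real Set

/-- The `L²([0,1])` norm of a real function. -/
noncomputable def L2norm (f : ℝ → ℝ) : ℝ := Real.sqrt (∫ s in (0:ℝ)..1, f s ^ 2)

/-- The Cole-Hopf transform `H`. -/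
noncomputable def coleHopfH (u : ℝ → ℝ) : ℝ → ℝ := fun x =>
  Real.exp (-(1/2) * ∫ s in (0:ℝ)..x, u s) /
    ∫ y in (0:ℝ)..1, Real.exp (-(1/2) * ∫ s in (0:ℝ)..y, u s)

/-- The cosine Fourier coefficient `cₙ(v) = √2 ∫₀¹ v(s) cos(nπs) ds`. -/
noncomputable def cCoef (n : ℕ) (v : ℝ → ℝ) : ℝ :=
  Real.sqrt 2 * ∫ s in (0:ℝ)..1, v s * Real.cos (n * π * s)

/-- `lₙ(u) = cₙ(H(u))`. -/
noncomputable def lCoef (n : ℕ) (u : ℝ → ℝ) : ℝ := cCoef n (coleHopfH u)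

/-- `u₀ ∈ Ω_B` : `u₀ ∈ L²([0,1])` with `2 e^{‖u₀‖} ‖u₀‖ < 1`. -/
def MemOmegaB (u₀ : ℝ → ℝ) : Prop :=
  IntervalIntegrable u₀ volume 0 1 ∧ IntervalIntegrable (fun s => u₀ s ^ 2) volume 0 1 ∧
    2 * Real.exp (L2norm u₀) * L2norm u₀ < 1

/-- The heat evolution `v(t,x) = 1 + Σ_{n≥1} e^{-n²π²t} lₙ(u₀) √2 cos(nπx)`. -/
noncomputable def heatV (u₀ : ℝ → ℝ) (t x : ℝ) : ℝ :=
  1 + ∑' n : ℕ+, Real.exp (-((n : ℕ) : ℝ) ^ 2 * π ^ 2 * t) * lCoef (n : ℕ) u₀ *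
    (Real.sqrt 2 * Real.cos (((n : ℕ) : ℝ) * π * x))

/-- The spatial derivative of the heat evolution,
`∂ₓv(t,x) = -Σ_{n≥1} e^{-n²π²t} lₙ(u₀) √2 nπ sin(nπx)`. -/
noncomputable def heatVx (u₀ : ℝ → ℝ) (t x : ℝ) : ℝ :=
  -∑' n : ℕ+, Real.exp (-((n : ℕ) : ℝ) ^ 2 * π ^ 2 * t) * lCoef (n : ℕ) u₀ *
    (Real.sqrt 2 * ((n : ℕ) : ℝ) * π * Real.sin (((n : ℕ) : ℝ) * π * x))

/-- The Burgers evolution `u(t,x) = -2 ∂ₓv(t,x) / v(t,x)`. -/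
noncomputable def burgersU (u₀ : ℝ → ℝ) (t x : ℝ) : ℝ := -2 * heatVx u₀ t x / heatV u₀ t x

/-- The Koopman index set `𝒜`: a tuple `ν = (n₀, n₁, …, n_{α(ν)})` of positive integers,
encoded as the head `n₀ : ℕ+` together with the (possibly empty) list `(n₁, …, n_{α(ν)})`. -/
abbrev KoopIdx : Type := ℕ+ × List ℕ+

/-- The Koopman eigenvalue `λ_ν = -π² Σ_{k=0}^{α(ν)} n_k²`. -/
noncomputable def lamIdx (ν : KoopIdx) : ℝ :=
  -π ^ 2 * ((((ν.1 : ℕ) : ℝ)) ^ 2 + (ν.2.map (fun k => (((k : ℕ) : ℝ)) ^ 2)).sum)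

/-- The Koopman mode
`a_ν(x) = (-1)^{α(ν)} 2^{(α(ν)+3)/2} n₀ π sin(n₀πx) ∏_{k=1}^{α(ν)} cos(n_kπx)`. -/
noncomputable def aIdx (ν : KoopIdx) (x : ℝ) : ℝ :=
  (-1 : ℝ) ^ ν.2.length * (2 : ℝ) ^ (((ν.2.length : ℝ) + 3) / 2) * ((ν.1 : ℕ) : ℝ) * π *
    Real.sin (((ν.1 : ℕ) : ℝ) * π * x) *
    (ν.2.map (fun k => Real.cos (((k : ℕ) : ℝ) * π * x))).prod

/-- The Koopman eigenfunctional `φ_ν(u₀) = ∏_{k=0}^{α(ν)} l_{n_k}(u₀)`. -/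
noncomputable def phiIdx (u₀ : ℝ → ℝ) (ν : KoopIdx) : ℝ :=
  lCoef (ν.1 : ℕ) u₀ * (ν.2.map (fun k => lCoef (k : ℕ) u₀)).prod


theorem aux_tuple {ι : Type*} (b : ι → ℝ) (hb : Summable (fun i => |b i|)) (n : ℕ) :
    Summable (fun f : Fin n → ι => |∏ i, b (f i)|) ∧
      ∑' f : Fin n → ι, ∏ i, b (f i) = (∑' i, b i) ^ n := by
  induction n with
  | zero =>
    refine ⟨(hasSum_fintype _).summable, ?_⟩
    rw [tsum_fintype]
    simp
  | succ n ih =>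
    have e := Fin.consEquiv (n := n) (fun _ => ι)
    have h1 : ∀ p : ι × (Fin n → ι), ∏ i, b ((Fin.consEquiv (n := n) (fun _ => ι)) p i)
        = b p.1 * ∏ i, b (p.2 i) := by
      intro p
      simp [Fin.prod_univ_succ, Fin.consEquiv]
    constructor
    · rw [← (Fin.consEquiv (n := n) (fun _ => ι)).summable_iff]
      have := Summable.mul_norm (f := b) (g := fun f : Fin n → ι => ∏ i, b (f i)) hb ih.1
      refine this.congr fun p => ?_
      simp only [Function.comp, h1, Real.norm_eq_abs]
    · rw [← (Fin.consEquiv (n := n) (fun _ => ι)).tsum_eq]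
      simp only [h1]
      rw [← tsum_mul_tsum_of_summable_norm (f := b) (g := fun f : Fin n → ι => ∏ i, b (f i)) hb ih.1,
        ih.2, pow_succ']

theorem aux_list {ι : Type*} (b : ι → ℝ) (hb : Summable (fun i => |b i|))
    (h1 : ∑' i, |b i| < 1) :
    Summable (fun l : List ι => |(l.map b).prod|) ∧
      ∑' l : List ι, (l.map b).prod = (1 - ∑' i, b i)⁻¹ := by
  have hkey : ∀ p : Σ n, Fin n → ι, (((List.equivSigmaTuple (α := ι)).symm p).map b).prod
      = ∏ i, b (p.2 i) := by
    intro p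
    simp [List.equivSigmaTuple, List.map_ofFn, List.prod_ofFn]
  have hs : Summable (fun p : Σ n, Fin n → ι => |∏ i, b (p.2 i)|) := by
    rw [summable_sigma_of_nonneg (fun _ => abs_nonneg _)]
    refine ⟨fun n => (aux_tuple b hb n).1, ?_⟩
    have h2 := fun n => (aux_tuple (fun i => |b i|) (by simpa using hb) n).2
    simp only [Finset.abs_prod, h2]
    exact summable_geometric_of_lt_one (tsum_nonneg fun _ => abs_nonneg _) h1
  constructor
  · rw [← (List.equivSigmaTuple (α := ι)).symm.summable_iff]
    refine hs.congr fun p => ?_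
    simp only [Function.comp, hkey]
  · rw [← (List.equivSigmaTuple (α := ι)).symm.tsum_eq]
    simp only [hkey]
    have hs2 : Summable (fun p : Σ n, Fin n → ι => ∏ i, b (p.2 i)) := hs.of_abs
    rw [hs2.tsum_sigma]
    have h3 := fun n => (aux_tuple b hb n).2
    simp only [h3]
    refine tsum_geometric_of_abs_lt_one (lt_of_le_of_lt ?_ h1)
    have h4 : ‖∑' i, b i‖ ≤ ∑' i, ‖b i‖ := norm_tsum_le_tsum_norm (by simpa only [Real.norm_eq_abs] using hb)
    simpa only [Real.norm_eq_abs] using h4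

/-- Algebraic heart: from the scalar series to the Koopman series. -/
theorem aux_koop (u₀ : ℝ → ℝ) (x : ℝ)
    (hs : Summable (fun n : ℕ+ => |lCoef n u₀|))
    (hlt : ∑' n : ℕ+, √2 * |lCoef n u₀| < 1)
    (hs' : Summable (fun n : ℕ+ => (n : ℝ) * |lCoef n u₀|)) :
    Summable (fun ν : KoopIdx => |phiIdx u₀ ν * aIdx ν x|) ∧
      (∑' ν : KoopIdx, phiIdx u₀ ν * aIdx ν x) =
        (2 * ∑' n : ℕ+, √2 * lCoef n u₀ * (n * π * Real.sin (n * π * x))) *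
        (1 + ∑' n : ℕ+, √2 * lCoef n u₀ * Real.cos (n * π * x))⁻¹ := by
  set A : ℕ+ → ℝ := fun n => 2 * (√2 * lCoef n u₀ * (n * π * Real.sin (n * π * x))) with hA
  set b : ℕ+ → ℝ := fun n => -(√2 * lCoef n u₀ * Real.cos (n * π * x)) with hb
  have hterm : ∀ ν : KoopIdx, phiIdx u₀ ν * aIdx ν x = A ν.1 * (ν.2.map b).prod := by
    rintro ⟨n, l⟩
    have h2 : (2:ℝ) ^ (((l.length : ℝ) + 3) / 2) = 2 * √2 * √2 ^ l.length := by
      rw [Real.sqrt_eq_rpow, ← Real.rpow_natCast, ← Real.rpow_mul (by norm_num)]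
      rw [show ((l.length : ℝ) + 3) / 2 = 1 + 1/2 + 1 / 2 * (l.length : ℝ) by ring,
        Real.rpow_add (by norm_num), Real.rpow_add (by norm_num), Real.rpow_one]
    have h3 : (l.map b).prod = (-1) ^ l.length * √2 ^ l.length *
        (l.map (fun k : ℕ+ => lCoef (k : ℕ) u₀)).prod *
        (l.map (fun k : ℕ+ => Real.cos (((k : ℕ) : ℝ) * π * x))).prod := by
      clear h2
      induction l with
      | nil => simp
      | cons k l ih =>
        simp only [List.map_cons, List.prod_cons, ih, List.length_cons]
        simp only [hb]
        ring
    simp only [phiIdx, aIdx, h2, h3, hA, List.bind_eq_flatMap, List.pure_def,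
      ← List.map_eq_flatMap, List.map_map, Function.comp_def]
    ring
  have hbabs : ∀ n, |b n| ≤ √2 * |lCoef n u₀| := by
    intro n
    simp only [hb, abs_neg, abs_mul, abs_of_nonneg (Real.sqrt_nonneg 2)]
    exact mul_le_of_le_one_right (by positivity) (Real.abs_cos_le_one _)
  have hbs : Summable (fun n => |b n|) :=
    Summable.of_nonneg_of_le (fun _ => abs_nonneg _) hbabs (hs.mul_left _)
  have hblt : ∑' n, |b n| < 1 := lt_of_le_of_lt (hbs.tsum_le_tsum hbabs (hs.mul_left _)) hlt
  have hAs : Summable (fun n => |A n|) := by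
    refine Summable.of_nonneg_of_le (fun _ => abs_nonneg _) (fun n => ?_) (hs'.mul_left (2 * √2 * π))
    simp only [hA, abs_mul, abs_of_nonneg (Real.sqrt_nonneg 2), abs_of_pos Real.pi_pos, Nat.abs_cast, abs_two]
    have := Real.abs_sin_le_one ((n:ℝ) * π * x)
    calc _ = 2 * √2 * π * (n * |lCoef n u₀|) * |Real.sin ((n:ℝ) * π * x)| := by ring
      _ ≤ _ := mul_le_of_le_one_right (by positivity) this
  obtain ⟨hl1, hl2⟩ := aux_list b hbs hblt
  simp only [hterm]
  constructor
  · exact Summable.mul_norm (f := A) (g := fun l : List ℕ+ => (l.map b).prod) hAs hl1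
  · rw [← tsum_mul_tsum_of_summable_norm (f := A) (g := fun l : List ℕ+ => (l.map b).prod) hAs hl1,
      hl2, hA, tsum_mul_left, hb, tsum_neg, sub_neg_eq_add]

theorem aux_bessel (e : ℕ+ → ℝ → ℝ) (he : ∀ n, Continuous (e n))
    (ho : ∀ n m, ∫ s in (0:ℝ)..1, e n s * e m s = if n = m then 1 else 0)
    (f : ℝ → ℝ) (hf : IntervalIntegrable f volume 0 1)
    (hf2 : IntervalIntegrable (fun s => f s ^ 2) volume 0 1) :
    Summable (fun n => (∫ s in (0:ℝ)..1, f s * e n s) ^ 2) ∧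
      ∑' n, (∫ s in (0:ℝ)..1, f s * e n s) ^ 2 ≤ ∫ s in (0:ℝ)..1, f s ^ 2 := by
  set c : ℕ+ → ℝ := fun n => ∫ s in (0:ℝ)..1, f s * e n s with hc
  have hfe : ∀ n, IntervalIntegrable (fun s => f s * e n s) volume 0 1 := fun n =>
    hf.mul_continuousOn (he n).continuousOn
  have key : ∀ F : Finset ℕ+, ∑ n ∈ F, c n ^ 2 ≤ ∫ s in (0:ℝ)..1, f s ^ 2 := by
    intro F
    set S : ℝ → ℝ := fun s => ∑ n ∈ F, c n * e n s with hS
    have hSc : Continuous S := continuous_finsetSum _ fun n _ => (he n).const_mul _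
    have h1 : ∫ s in (0:ℝ)..1, f s * S s = ∑ n ∈ F, c n ^ 2 := by
      simp only [hS, Finset.mul_sum]
      rw [intervalIntegral.integral_finsetSum]
      · refine Finset.sum_congr rfl fun n _ => ?_
        rw [pow_two]
        conv_rhs => rw [hc]
        rw [← intervalIntegral.integral_const_mul]
        congr 1; ext s; simp only [hc]; ring
      · intro n _
        have := (hfe n).const_mul (c n)
        refine this.congr fun s _ => ?_
        ring
    have h2 : ∫ s in (0:ℝ)..1, S s * S s = ∑ n ∈ F, c n ^ 2 := by
      have : ∀ m ∈ F, ∫ s in (0:ℝ)..1, S s * e m s = c m := by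
        intro m hm
        simp only [hS, Finset.sum_mul, mul_assoc]
        rw [intervalIntegral.integral_finsetSum]
        · simp only [intervalIntegral.integral_const_mul, ho]
          simp [hm]
        · intro n _
          exact (((he n).mul (he m)).const_mul _).intervalIntegrable _ _
      conv_lhs => rw [hS]
      simp only [Finset.mul_sum]
      rw [intervalIntegral.integral_finsetSum]
      · refine Finset.sum_congr rfl fun n hn => ?_
        have h3 := this n hn
        have h5 : c n ^ 2 = c n * ∫ s in (0:ℝ)..1, S s * e n s := by rw [h3, pow_two]
        rw [h5, ← intervalIntegral.integral_const_mul]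
        congr 1; ext s; simp only [hS]; ring
      · intro n _
        exact (hSc.mul ((he n).const_mul _)).intervalIntegrable _ _
    have h3 : 0 ≤ ∫ s in (0:ℝ)..1, (f s - S s) ^ 2 :=
      intervalIntegral.integral_nonneg (by norm_num) fun s _ => sq_nonneg _
    have hfS : IntervalIntegrable (fun s => f s * S s) volume 0 1 :=
      hf.mul_continuousOn hSc.continuousOn
    have hSS : IntervalIntegrable (fun s => S s * S s) volume 0 1 :=
      (hSc.mul hSc).intervalIntegrable _ _
    have h4 : ∫ s in (0:ℝ)..1, (f s - S s) ^ 2 = (∫ s in (0:ℝ)..1, f s ^ 2)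
        - 2 * (∫ s in (0:ℝ)..1, f s * S s) + ∫ s in (0:ℝ)..1, S s * S s := by
      rw [← intervalIntegral.integral_const_mul, ← intervalIntegral.integral_sub hf2 (hfS.const_mul 2),
        ← intervalIntegral.integral_add (hf2.sub (hfS.const_mul 2)) hSS]
      congr 1; ext s; ring
    rw [h4, h1, h2] at h3
    linarith
  exact ⟨summable_of_sum_le (fun _ => sq_nonneg _) key,
    Real.tsum_le_of_sum_le (fun _ => sq_nonneg _) key⟩

theorem aux_Icos (k : ℤ) : ∫ s in (0:ℝ)..1, Real.cos (k * π * s) = if k = 0 then 1 else 0 := by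
  split_ifs with h
  · simp [h]
  · have hk : (k:ℝ) * π ≠ 0 := mul_ne_zero (by exact_mod_cast h) Real.pi_ne_zero
    rw [intervalIntegral.integral_comp_mul_left (fun y => Real.cos y) hk]
    simp [Real.sin_int_mul_pi]

theorem aux_orth_sin (n m : ℕ+) : ∫ s in (0:ℝ)..1, (√2 * Real.sin (n * π * s)) * (√2 * Real.sin (m * π * s))
    = if n = m then 1 else 0 := by
  have h : ∀ s : ℝ, (√2 * Real.sin (n * π * s)) * (√2 * Real.sin (m * π * s))
      = Real.cos (((n:ℤ) - (m:ℤ) : ℤ) * π * s) - Real.cos (((n:ℤ) + (m:ℤ) : ℤ) * π * s) := by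
    intro s
    push_cast
    rw [show ((n:ℝ) - m) * π * s = n * π * s - m * π * s by ring,
      show ((n:ℝ) + m) * π * s = n * π * s + m * π * s by ring, Real.cos_sub, Real.cos_add]
    linear_combination (Real.sin (n * π * s) * Real.sin (m * π * s)) * Real.mul_self_sqrt (show (0:ℝ) ≤ 2 by norm_num)
  simp only [h]
  rw [intervalIntegral.integral_sub (by apply Continuous.intervalIntegrable; fun_prop)
    (by apply Continuous.intervalIntegrable; fun_prop), aux_Icos, aux_Icos]
  have h1 : ((n:ℤ) + (m:ℤ)) ≠ 0 := by have := n.pos; have := m.pos; omega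
  rw [if_neg h1, sub_zero]
  congr 1
  rw [sub_eq_zero]; norm_cast

theorem aux_orth_cos (n m : ℕ+) : ∫ s in (0:ℝ)..1, (√2 * Real.cos (n * π * s)) * (√2 * Real.cos (m * π * s))
    = if n = m then 1 else 0 := by
  have h : ∀ s : ℝ, (√2 * Real.cos (n * π * s)) * (√2 * Real.cos (m * π * s))
      = Real.cos (((n:ℤ) - (m:ℤ) : ℤ) * π * s) + Real.cos (((n:ℤ) + (m:ℤ) : ℤ) * π * s) := by
    intro s
    push_cast
    rw [show ((n:ℝ) - m) * π * s = n * π * s - m * π * s by ring,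
      show ((n:ℝ) + m) * π * s = n * π * s + m * π * s by ring, Real.cos_sub, Real.cos_add]
    linear_combination (Real.cos (n * π * s) * Real.cos (m * π * s)) * Real.mul_self_sqrt (show (0:ℝ) ≤ 2 by norm_num)
  simp only [h]
  rw [intervalIntegral.integral_add (by apply Continuous.intervalIntegrable; fun_prop)
    (by apply Continuous.intervalIntegrable; fun_prop), aux_Icos, aux_Icos]
  have h1 : ((n:ℤ) + (m:ℤ)) ≠ 0 := by have := n.pos; have := m.pos; omega
  rw [if_neg h1, add_zero]
  congr 1
  rw [sub_eq_zero]; norm_cast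

theorem aux_fourier (v : ℝ → ℝ) (hv : Continuous v) (hi : ∫ s in (0:ℝ)..1, v s = 1)
    (hs : Summable (fun n : ℕ+ => |cCoef n v|)) (x : ℝ) (hx : x ∈ Ioo (0:ℝ) 1) :
    v x = 1 + ∑' n : ℕ+, √2 * cCoef n v * Real.cos (n * π * x) := by
  have : Fact ((0:ℝ) < 2) := ⟨by norm_num⟩
  set g : ℝ → ℂ := fun s => ((v |s| : ℝ) : ℂ) with hg
  have hgc : Continuous g := by fun_prop
  set F : C(AddCircle (2:ℝ), ℂ) := ⟨AddCircle.liftIco 2 (-1) g,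
    AddCircle.liftIco_continuous (by simp only [hg]; norm_num) hgc.continuousOn⟩ with hF
  set I : ℤ → ℝ := fun n => ∫ s in (0:ℝ)..1, v s * Real.cos (n * π * s) with hI
  have hcoef : ∀ n : ℤ, fourierCoeff F n = ((I n : ℝ) : ℂ) := by
    intro n
    have h1 : fourierCoeff F n = fourierCoeff (AddCircle.liftIco 2 (-1) g) n := rfl
    rw [h1, fourierCoeff_liftIco_eq, fourierCoeffOn_eq_integral]
    simp only [fourier_coe_apply]
    set G : ℝ → ℂ := fun s => Complex.exp (-(π * Complex.I * n * s)) * g s with hG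
    have hGc : Continuous G := by fun_prop
    have h2 : ∫ s in (-1:ℝ)..(-1+2), Complex.exp (2 * π * Complex.I * (-n : ℤ) * s / ((-1 + 2 - -1 : ℝ) : ℂ)) • g s
        = ∫ s in (-1:ℝ)..1, G s := by
      rw [show (-1 + 2 : ℝ) = 1 by norm_num]
      congr 1; ext s
      simp only [hG, smul_eq_mul]
      congr 2
      push_cast
      ring
    rw [h2, ← intervalIntegral.integral_add_adjacent_intervals (b := 0) (hGc.intervalIntegrable _ _) (hGc.intervalIntegrable _ _)]
    have h3 : ∫ s in (-1:ℝ)..0, G s = ∫ s in (0:ℝ)..1, G (-s) := by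
      rw [intervalIntegral.integral_comp_neg]; simp
    have hGn : Continuous (fun s => G (-s)) := hGc.comp continuous_neg
    rw [h3, ← intervalIntegral.integral_add (hGn.intervalIntegrable _ _) (hGc.intervalIntegrable _ _)]
    have h4 : ∫ s in (0:ℝ)..1, (G (-s) + G s) = ∫ s in (0:ℝ)..1, ((2 * (v s * Real.cos (n * π * s)) : ℝ) : ℂ) := by
      refine intervalIntegral.integral_congr fun s hs => ?_
      rw [uIcc_of_le (by norm_num)] at hs
      simp only [hG, hg, abs_neg, abs_of_nonneg hs.1]
      push_cast
      rw [Complex.cos]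
      ring_nf
    rw [h4, intervalIntegral.integral_ofReal, intervalIntegral.integral_const_mul]
    simp only [hI]
    rw [Complex.real_smul, ← Complex.ofReal_mul]
    congr 1
    norm_num
    ring
  have hIc : ∀ n : ℕ, cCoef n v = √2 * I n := fun n => by simp [cCoef, hI]
  have hIneg : ∀ n : ℤ, I (-n) = I n := by
    intro n
    simp only [hI]
    congr 1; ext s
    push_cast
    rw [show -(n:ℝ) * π * s = -(n * π * s) by ring, Real.cos_neg]
  have hI0 : I 0 = 1 := by simp [hI, hi]
  have h2pos : 0 < √2 := by positivity
  have hsumN : Summable (fun n : ℕ => I n) := by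
    have : Summable (fun n : ℕ+ => cCoef n v) := hs.of_abs
    rw [summable_pnat_iff_summable_nat (f := fun n : ℕ => cCoef n v)] at this
    refine (this.mul_left (√2)⁻¹).congr fun n => ?_
    rw [hIc]; field_simp
  have hsumZ : Summable I := by
    refine Summable.of_nat_of_neg hsumN ?_
    simpa only [hIneg] using hsumN
  have hsumF : Summable (fourierCoeff F) := by
    rw [show fourierCoeff F = fun n => ((I n : ℝ) : ℂ) from funext hcoef]
    exact_mod_cast hsumZ
  have hp := has_pointwise_sum_fourier_series_of_summable hsumF (x : AddCircle (2:ℝ))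
  have hFx : F (x : AddCircle (2:ℝ)) = ((v x : ℝ) : ℂ) := by
    have : F (x : AddCircle (2:ℝ)) = AddCircle.liftIco 2 (-1) g (x : AddCircle (2:ℝ)) := rfl
    rw [this, AddCircle.liftIco_coe_apply ⟨by linarith [hx.1], by linarith [hx.2]⟩]
    simp only [hg, abs_of_pos hx.1]
  rw [hFx] at hp
  have hq := hp.nat_add_neg
  have hr : HasSum (fun n : ℕ => 2 * (I n * Real.cos (n * π * x))) (v x + 1) := by
    rw [← Complex.hasSum_ofReal]
    convert! hq using 1
    · ext n
      simp only [hcoef, hIneg, fourier_coe_apply, smul_eq_mul]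
      push_cast
      rw [Complex.cos]
      ring_nf
    · simp [hcoef, hI0]
  have hr' : HasSum (fun n : ℕ+ => 2 * (I (n:ℕ) * Real.cos ((n:ℕ) * π * x))) (v x - 1) := by
    rw [hasSum_pnat_iff (f := fun n : ℕ => 2 * (I n * Real.cos (n * π * x)))]
    convert! hr using 1
    simp [hI0]; ring
  have hfin : (fun n : ℕ+ => √2 * cCoef n v * Real.cos (n * π * x)) =
      (fun n : ℕ+ => 2 * (I (n:ℕ) * Real.cos ((n:ℕ) * π * x))) := by
    ext n
    rw [hIc]
    linear_combination (I (n:ℕ) * Real.cos ((n:ℕ) * π * x)) * Real.mul_self_sqrt (show (0:ℝ) ≤ 2 by norm_num)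
  rw [hfin, hr'.tsum_eq]
  ring

theorem aux_ibp (u du g g' : ℝ → ℝ) (hdu : IntervalIntegrable du volume 0 1)
    (hAC : ∀ x ∈ Icc (0:ℝ) 1, u x = ∫ s in (0:ℝ)..x, du s) (hu1 : u 1 = 0)
    (hg : ∀ x, HasDerivAt g (g' x) x) (hg' : Continuous g') :
    ∫ s in (0:ℝ)..1, u s * g' s = - ∫ s in (0:ℝ)..1, du s * g s := by
  set f : ℝ → ℝ := fun x => ∫ s in (0:ℝ)..x, du s with hf
  have hfac : AbsolutelyContinuousOnInterval f 0 1 :=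
    hdu.absolutelyContinuousOnInterval_intervalIntegral (by simp)
  have hdg : deriv g = g' := funext fun x => (hg x).deriv
  have hgac : AbsolutelyContinuousOnInterval g 0 1 := by
    refine ContDiffOn.absolutelyContinuousOnInterval (ContDiff.contDiffOn ?_)
    rw [contDiff_one_iff_deriv, hdg]
    exact ⟨fun x => (hg x).differentiableAt, hg'⟩
  have h := hfac.integral_mul_deriv_eq_deriv_mul hgac
  have h0 : f 0 = 0 := by simp [hf]
  have h1 : f 1 = 0 := by rw [← hu1, hAC 1 (by simp)]
  have hae : ∫ s in (0:ℝ)..1, deriv f s * g s = ∫ s in (0:ℝ)..1, du s * g s := by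
    refine intervalIntegral.integral_congr_ae ?_
    filter_upwards [hdu.ae_hasDerivAt_integral] with x hx hx2
    rw [(hx (uIoc_subset_uIcc hx2) 0 (by simp)).deriv]
  rw [h0, h1, hae, hdg] at h
  have h2 : ∫ s in (0:ℝ)..1, u s * g' s = ∫ s in (0:ℝ)..1, f s * g' s := by
    refine intervalIntegral.integral_congr fun s hs => ?_
    rw [uIcc_of_le (by norm_num)] at hs
    simp only [hAC s hs, hf]
  rw [h2, h]; ring

theorem aux_v (u : ℝ → ℝ) (hu : Continuous u) :
    (∀ x, HasDerivAt (coleHopfH u) (-(1/2) * (u x * coleHopfH u x)) x) ∧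
    (∀ x, 0 < coleHopfH u x) ∧ (∫ s in (0:ℝ)..1, coleHopfH u s = 1) ∧
    (∀ x ∈ Icc (0:ℝ) 1, coleHopfH u x ≤ Real.exp (L2norm u)) ∧ 0 ≤ L2norm u ∧
    ∫ s in (0:ℝ)..1, u s ^ 2 = L2norm u ^ 2 := by
  set E : ℝ → ℝ := fun x => Real.exp (-(1/2) * ∫ s in (0:ℝ)..x, u s) with hE
  set N := L2norm u with hN
  have hdE : ∀ x, HasDerivAt E (-(1/2) * (u x * E x)) x := by
    intro x
    have h1 : HasDerivAt (fun x => ∫ s in (0:ℝ)..x, u s) (u x) x :=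
      hu.integral_hasStrictDerivAt 0 x |>.hasDerivAt
    convert! (h1.const_mul (-(1/2))).exp using 1
    simp only [hE]; ring
  have hEc : Continuous E := continuous_iff_continuousAt.2 fun x => (hdE x).continuousAt
  have hEpos : ∀ x, 0 < E x := fun x => Real.exp_pos _
  have hN0 : 0 ≤ N := Real.sqrt_nonneg _
  have hNsq : ∫ s in (0:ℝ)..1, u s ^ 2 = N ^ 2 := by
    rw [hN, L2norm, Real.sq_sqrt]
    exact intervalIntegral.integral_nonneg (by norm_num) fun s _ => sq_nonneg _
  set m := ∫ s in (0:ℝ)..1, |u s| with hm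
  have hmN : m ≤ N := by
    have h1 : 0 ≤ ∫ s in (0:ℝ)..1, (|u s| - m) ^ 2 :=
      intervalIntegral.integral_nonneg (by norm_num) fun s _ => sq_nonneg _
    have h2 : ∫ s in (0:ℝ)..1, (|u s| - m) ^ 2 = N ^ 2 - 2 * m * m + m ^ 2 := by
      have : ∀ s, (|u s| - m) ^ 2 = u s ^ 2 - 2 * m * |u s| + m ^ 2 := by
        intro s; rw [← sq_abs (u s)]; ring
      simp only [this]
      rw [intervalIntegral.integral_add (by apply Continuous.intervalIntegrable; fun_prop)
        (by apply Continuous.intervalIntegrable; fun_prop),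
        intervalIntegral.integral_sub (by apply Continuous.intervalIntegrable; fun_prop)
        (by apply Continuous.intervalIntegrable; fun_prop), intervalIntegral.integral_const_mul, hNsq]
      simp [hm]
    rw [h2] at h1
    exact le_of_sq_le_sq (by nlinarith) hN0
  have hU : ∀ x ∈ Icc (0:ℝ) 1, |∫ s in (0:ℝ)..x, u s| ≤ N := by
    intro x hx
    refine le_trans (intervalIntegral.abs_integral_le_integral_abs hx.1) (le_trans ?_ hmN)
    exact intervalIntegral.integral_mono_interval le_rfl hx.1 hx.2
      (Filter.Eventually.of_forall fun _ => abs_nonneg _) (hu.abs.intervalIntegrable _ _)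
  set Z := ∫ y in (0:ℝ)..1, E y with hZ
  have hZlow : Real.exp (-(N/2)) ≤ Z := by
    have : ∫ y in (0:ℝ)..1, Real.exp (-(N/2)) ≤ Z := by
      refine intervalIntegral.integral_mono_on (by norm_num) (by simp) (hEc.intervalIntegrable _ _) ?_
      intro x hx
      simp only [hE]
      have := (abs_le.1 (hU x hx)).2
      exact Real.exp_le_exp.2 (by linarith)
    simpa using this
  have hZpos : 0 < Z := lt_of_lt_of_le (Real.exp_pos _) hZlow
  have hv : coleHopfH u = fun x => E x / Z := rfl
  refine ⟨fun x => ?_, fun x => ?_, ?_, fun x hx => ?_, hN0, hNsq⟩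
  · rw [hv]
    convert! (hdE x).div_const Z using 1
    ring
  · rw [hv]; exact div_pos (hEpos x) hZpos
  · rw [hv, intervalIntegral.integral_div]
    exact div_self hZpos.ne'
  · rw [hv]
    simp only
    rw [div_le_iff₀ hZpos]
    calc E x ≤ Real.exp (N/2) := by
          simp only [hE]
          have := (abs_le.1 (hU x hx)).1
          exact Real.exp_le_exp.2 (by linarith)
      _ = Real.exp N * Real.exp (-(N/2)) := by rw [← Real.exp_add]; congr 1; ring
      _ ≤ _ := by gcongr

theorem aux_sum1 : Summable (fun n : ℕ+ => 1 / ((n:ℕ):ℝ) ^ 2) ∧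
    ∑' n : ℕ+, 1 / ((n:ℕ):ℝ) ^ 2 = π ^ 2 / 6 := by
  have h : HasSum (fun n : ℕ+ => 1 / ((n:ℕ):ℝ) ^ 2) (π ^ 2 / 6) := by
    rw [hasSum_pnat_iff (f := fun n : ℕ => 1 / (n:ℝ) ^ 2)]
    simpa using hasSum_zeta_two
  exact ⟨h.summable, h.tsum_eq⟩

theorem aux_coef (u du : ℝ → ℝ) (hu : Continuous u) (hdu : IntervalIntegrable du volume 0 1)
    (hAC : ∀ x ∈ Icc (0:ℝ) 1, u x = ∫ s in (0:ℝ)..x, du s) (hu1 : u 1 = 0) (n : ℕ+) :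
    lCoef n u = (1 / (n * π)) *
      ∫ s in (0:ℝ)..1, (1/2 * (u s * coleHopfH u s)) * (√2 * Real.sin (n * π * s)) ∧
    lCoef n u = (1 / (n * π) ^ 2) *
      ∫ s in (0:ℝ)..1, (1/2 * (u s * (-(1/2) * (u s * coleHopfH u s)) + du s * coleHopfH u s)) *
        (√2 * Real.cos (n * π * s)) := by
  obtain ⟨hd, -, -, -, -, -⟩ := aux_v u hu
  set v := coleHopfH u with hv
  have hvc : Continuous v := continuous_iff_continuousAt.2 fun x => (hd x).continuousAt
  have hnp : (n:ℝ) * π ≠ 0 := by positivity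
  set k : ℝ := n * π with hk
  have hsin : ∀ x, HasDerivAt (fun s => Real.sin (k * s)) (k * Real.cos (k * x)) x := by
    intro x
    convert! ((hasDerivAt_id x).const_mul k).sin using 1
    simp; ring
  have hcos : ∀ x, HasDerivAt (fun s => Real.cos (k * s)) (-(k * Real.sin (k * x))) x := by
    intro x
    convert! ((hasDerivAt_id x).const_mul k).cos using 1
    simp; ring
  have hs0 : Real.sin (k * 1) = 0 := by simp [hk]
  have h1 : k * ∫ s in (0:ℝ)..1, v s * Real.cos (k * s)
      = 1/2 * ∫ s in (0:ℝ)..1, (u s * v s) * Real.sin (k * s) := by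
    have := intervalIntegral.integral_mul_deriv_eq_deriv_mul (a := 0) (b := 1)
      (fun x _ => hd x) (fun x _ => hsin x)
      (by apply Continuous.intervalIntegrable; fun_prop)
      (by apply Continuous.intervalIntegrable; fun_prop)
    rw [hs0] at this
    simp only [mul_zero, Real.sin_zero, sub_zero, zero_sub] at this
    rw [← intervalIntegral.integral_const_mul, ← intervalIntegral.integral_const_mul]
    rw [← intervalIntegral.integral_neg] at this
    convert this using 2
    · ext s; ring
    · ext s; ring
  have h2 : k * ∫ s in (0:ℝ)..1, (u s * v s) * Real.sin (k * s) =
      ∫ s in (0:ℝ)..1, (u s * (-(1/2) * (u s * v s)) + du s * v s) * Real.cos (k * s) := by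
    have hg : ∀ x, HasDerivAt (fun s => v s * Real.cos (k * s))
        ((-(1/2) * (u x * v x)) * Real.cos (k * x) + v x * (-(k * Real.sin (k * x)))) x :=
      fun x => (hd x).mul (hcos x)
    have := aux_ibp u du _ _ hdu hAC hu1 hg (by fun_prop)
    have e1 : IntervalIntegrable (fun s => du s * (v s * Real.cos (k * s))) volume 0 1 :=
      hdu.mul_continuousOn (by fun_prop)
    have e2 : IntervalIntegrable (fun s => u s * ((-(1/2) * (u s * v s)) * Real.cos (k * s))) volume 0 1 := by
      apply Continuous.intervalIntegrable; fun_prop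
    have e3 : IntervalIntegrable (fun s => k * ((u s * v s) * Real.sin (k * s))) volume 0 1 := by
      apply Continuous.intervalIntegrable; fun_prop
    have e4 : ∫ s in (0:ℝ)..1, u s * ((-(1/2) * (u s * v s)) * Real.cos (k * s) + v s * (-(k * Real.sin (k * s))))
        = (∫ s in (0:ℝ)..1, u s * ((-(1/2) * (u s * v s)) * Real.cos (k * s)))
          - ∫ s in (0:ℝ)..1, k * ((u s * v s) * Real.sin (k * s)) := by
      rw [← intervalIntegral.integral_sub e2 e3]
      congr 1; ext s; ring
    have e5 : ∫ s in (0:ℝ)..1, (u s * (-(1/2) * (u s * v s)) + du s * v s) * Real.cos (k * s)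
        = (∫ s in (0:ℝ)..1, u s * ((-(1/2) * (u s * v s)) * Real.cos (k * s)))
          + ∫ s in (0:ℝ)..1, du s * (v s * Real.cos (k * s)) := by
      rw [← intervalIntegral.integral_add e2 e1]
      congr 1; ext s; ring
    rw [e5, ← intervalIntegral.integral_const_mul]
    rw [e4] at this
    linarith
  have hl : lCoef n u = √2 * ∫ s in (0:ℝ)..1, v s * Real.cos (k * s) := rfl
  have h3 : ∫ s in (0:ℝ)..1, (1/2 * (u s * v s)) * (√2 * Real.sin (k * s))
      = 1/2 * √2 * ∫ s in (0:ℝ)..1, (u s * v s) * Real.sin (k * s) := by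
    rw [← intervalIntegral.integral_const_mul]; congr 1; ext s; ring
  have h4 : ∫ s in (0:ℝ)..1, (1/2 * (u s * (-(1/2) * (u s * v s)) + du s * v s)) *
        (√2 * Real.cos (k * s))
      = 1/2 * √2 * ∫ s in (0:ℝ)..1, (u s * (-(1/2) * (u s * v s)) + du s * v s) * Real.cos (k * s) := by
    rw [← intervalIntegral.integral_const_mul]; congr 1; ext s; ring
  rw [h3, h4, ← h2, hl]
  constructor
  · field_simp
    linear_combination 2 * h1
  · field_simp
    linear_combination 2 * h1

theorem aux_main (u du : ℝ → ℝ) (hu : Continuous u)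
    (hsmall : 2 * Real.exp (L2norm u) * L2norm u < 1)
    (hdu : IntervalIntegrable du volume 0 1)
    (hdu2 : IntervalIntegrable (fun s => du s ^ 2) volume 0 1)
    (hAC : ∀ x ∈ Icc (0:ℝ) 1, u x = ∫ s in (0:ℝ)..x, du s) (hu1 : u 1 = 0)
    (x : ℝ) (hx : x ∈ Icc (0:ℝ) 1) :
    Summable (fun ν : KoopIdx => |phiIdx u ν * aIdx ν x|) ∧
      (∑' ν : KoopIdx, phiIdx u ν * aIdx ν x) = u x := by
  obtain ⟨hd, hpos, hvone, hbd, hN0, hNsq⟩ := aux_v u hu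
  have hcf := aux_coef u du hu hdu hAC hu1
  set v := coleHopfH u with hv
  set N := L2norm u with hN
  have hvc : Continuous v := continuous_iff_continuousAt.2 fun x => (hd x).continuousAt
  have hpi := Real.pi_pos
  obtain ⟨hz1, hz2⟩ := aux_sum1
  -- first Bessel inequality
  have hf1c : Continuous (fun s => 1/2 * (u s * v s)) := by fun_prop
  obtain ⟨b1, b2⟩ := aux_bessel (fun n s => √2 * Real.sin (n * π * s)) (fun n => by fun_prop)
    aux_orth_sin (fun s => 1/2 * (u s * v s)) (hf1c.intervalIntegrable _ _)
    ((hf1c.pow 2).intervalIntegrable _ _)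
  have b3 : ∫ s in (0:ℝ)..1, (1/2 * (u s * v s)) ^ 2 ≤ 1/16 := by
    have h1 : ∫ s in (0:ℝ)..1, (1/2 * (u s * v s)) ^ 2 ≤
        ∫ s in (0:ℝ)..1, (1/4 * Real.exp N ^ 2) * u s ^ 2 := by
      refine intervalIntegral.integral_mono_on (by norm_num) ((hf1c.pow 2).intervalIntegrable _ _)
        (by apply Continuous.intervalIntegrable; fun_prop) fun s hs => ?_
      have h2 : v s ^ 2 ≤ Real.exp N ^ 2 := pow_le_pow_left₀ (hpos s).le (hbd s hs) 2
      nlinarith [sq_nonneg (u s)]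
    rw [intervalIntegral.integral_const_mul, hNsq] at h1
    have h3 : 0 ≤ Real.exp N * N := by positivity
    nlinarith
  set S : ℕ+ → ℝ := fun n => ∫ s in (0:ℝ)..1, (1/2 * (u s * v s)) * (√2 * Real.sin (n * π * s)) with hS
  have hb : ∀ n : ℕ+, √2 * |lCoef n u| ≤ S n ^ 2 + 1 / (2 * π ^ 2) * (1 / (n:ℝ) ^ 2) := by
    intro n
    have hn : (0:ℝ) < n := by exact_mod_cast n.pos
    have h1 : lCoef n u = 1 / (n * π) * S n := (hcf n).1
    rw [h1, abs_mul, abs_of_pos (by positivity)]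
    have h2 := sq_nonneg (|S n| - √2 * (1 / (n * π)) / 2)
    have h3 : (√2 * (1 / (n * π)) / 2) ^ 2 = 1 / (2 * π ^ 2) * (1 / (n:ℝ) ^ 2) := by
      rw [div_pow, mul_pow, Real.sq_sqrt (by norm_num)]; field_simp
    rw [← h3, ← sq_abs (S n)]
    nlinarith
  have hsum2 : Summable (fun n : ℕ+ => √2 * |lCoef n u|) :=
    Summable.of_nonneg_of_le (fun _ => by positivity) hb (b1.add (hz1.mul_left _))
  have hlt : ∑' n : ℕ+, √2 * |lCoef n u| < 1 := by
    have h1 := hsum2.tsum_le_tsum hb (b1.add (hz1.mul_left _))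
    rw [b1.tsum_add (hz1.mul_left _), tsum_mul_left (f := fun n : ℕ+ => 1 / ((n:ℕ):ℝ) ^ 2), hz2] at h1
    have h2 : 1 / (2 * π ^ 2) * (π ^ 2 / 6) = 1/12 := by field_simp; norm_num
    rw [h2] at h1
    have h3 : ∑' n, S n ^ 2 ≤ 1/16 := b2.trans b3
    linarith
  have hs : Summable (fun n : ℕ+ => |lCoef n u|) := by
    refine (hsum2.mul_left (√2)⁻¹).congr fun n => ?_
    field_simp
  -- second Bessel inequality
  set w : ℝ → ℝ := fun s => 1/2 * (u s * (-(1/2) * (u s * v s)) + du s * v s) with hw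
  have hwi : IntervalIntegrable w volume 0 1 := by
    refine IntervalIntegrable.const_mul (IntervalIntegrable.add ?_ ?_) _
    · apply Continuous.intervalIntegrable; fun_prop
    · exact hdu.mul_continuousOn hvc.continuousOn
  have hw2 : IntervalIntegrable (fun s => w s ^ 2) volume 0 1 := by
    have e1 : IntervalIntegrable (fun s => 1/16 * (u s ^ 2 * v s) ^ 2) volume 0 1 := by
      apply Continuous.intervalIntegrable; fun_prop
    have e2 : IntervalIntegrable (fun s => du s * (-(1/4) * (u s ^ 2 * v s ^ 2))) volume 0 1 :=
      hdu.mul_continuousOn (by fun_prop)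
    have e3 : IntervalIntegrable (fun s => du s ^ 2 * (1/4 * v s ^ 2)) volume 0 1 :=
      hdu2.mul_continuousOn (by fun_prop)
    refine ((e1.add e2).add e3).congr fun s _ => ?_
    simp only [hw, Pi.add_apply]
    ring
  obtain ⟨c1, -⟩ := aux_bessel (fun n s => √2 * Real.cos (n * π * s)) (fun n => by fun_prop)
    aux_orth_cos w hwi hw2
  have hs' : Summable (fun n : ℕ+ => (n : ℝ) * |lCoef n u|) := by
    refine Summable.of_nonneg_of_le (fun _ => by positivity) (fun n => ?_)
      ((c1.add hz1).mul_left (1 / (2 * π ^ 2)))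
    have hn : (0:ℝ) < n := by exact_mod_cast n.pos
    have h1 := (hcf n).2
    set C : ℝ := ∫ s in (0:ℝ)..1, w s * (√2 * Real.cos (n * π * s)) with hC
    have h1' : lCoef n u = (1 / (n * π) ^ 2) * C := h1
    rw [h1', abs_mul, abs_of_pos (by positivity)]
    have h2 := sq_nonneg (|C| - 1 / n)
    have h3 : (n:ℝ) * (1 / (n * π) ^ 2 * |C|) = 1 / (2 * π ^ 2) * (2 * |C| * (1 / n)) := by
      field_simp
    rw [h3]
    refine mul_le_mul_of_nonneg_left ?_ (by positivity)
    rw [← sq_abs C, ← one_div_pow]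
    nlinarith
  obtain ⟨r1, r2⟩ := aux_koop u x hs hlt hs'
  refine ⟨r1, ?_⟩
  rw [r2]
  have hu0 : u 0 = 0 := by rw [hAC 0 (by simp)]; simp
  rcases eq_or_lt_of_le hx.1 with h0 | h0
  · simp [← h0, hu0]
  rcases eq_or_lt_of_le hx.2 with h1 | h1
  · simp [h1, hu1]
  have hxo : x ∈ Ioo (0:ℝ) 1 := ⟨h0, h1⟩
  have hF : ∀ y ∈ Ioo (0:ℝ) 1, v y = 1 + ∑' n : ℕ+, √2 * lCoef n u * Real.cos (n * π * y) :=
    fun y hy => aux_fourier v hvc hvone hs y hy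
  have hder : HasDerivAt (fun y => ∑' n : ℕ+, √2 * lCoef n u * Real.cos (n * π * y))
      (∑' n : ℕ+, -(√2 * lCoef n u * (n * π * Real.sin (n * π * x)))) x := by
    refine hasDerivAt_tsum (g' := fun (n : ℕ+) y => -(√2 * lCoef n u * (n * π * Real.sin (n * π * y)))) (hs'.mul_left (√2 * π)) (y₀ := 0) ?_ ?_ ?_ x
    · intro n y
      convert! ((((hasDerivAt_id y).const_mul ((n:ℝ) * π)).cos).const_mul (√2 * lCoef n u)) using 1
      simp only [id, mul_one]; ring
    · intro n y
      rw [norm_neg, Real.norm_eq_abs]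
      simp only [abs_mul, abs_of_nonneg (Real.sqrt_nonneg 2), abs_of_pos hpi, Nat.abs_cast]
      calc _ = √2 * π * (n * |lCoef n u|) * |Real.sin ((n:ℝ) * π * y)| := by ring
        _ ≤ _ := mul_le_of_le_one_right (by positivity) (Real.abs_sin_le_one _)
    · simpa using hs.of_abs.mul_left (√2)
  have hder2 : HasDerivAt v (∑' n : ℕ+, -(√2 * lCoef n u * (n * π * Real.sin (n * π * x)))) x := by
    refine (hder.const_add 1).congr_of_eventuallyEq ?_
    filter_upwards [Ioo_mem_nhds h0 h1] with y hy using hF y hy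
  have huniq := hder2.unique (hd x)
  rw [tsum_neg] at huniq
  rw [← hF x hxo]
  have hvp := (hpos x).ne'
  rw [← div_eq_mul_inv, div_eq_iff hvp]
  linarith

/-- **Completeness of the Koopman modes at `t = 0`.** For `u₀ ∈ ω_B`
(i.e. `u₀ ∈ Ω_B` absolutely continuous with weak derivative `du ∈ L²([0,1])` and
`u₀(0) = u₀(1) = 0`) and every `x ∈ [0,1]`, the family `(φ_ν(u₀) a_ν(x))_ν` is absolutely
summable and `Σ_ν φ_ν(u₀) a_ν(x) = u₀(x)`. -/
theorem koopman_completeness (u₀ du : ℝ → ℝ) (h : MemOmegaB u₀)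
    (hdu_int : IntervalIntegrable du volume 0 1)
    (hdu_sq : IntervalIntegrable (fun s => du s ^ 2) volume 0 1)
    (hAC : ∀ x ∈ Icc (0:ℝ) 1, u₀ x = u₀ 0 + ∫ s in (0:ℝ)..x, du s)
    (hb0 : u₀ 0 = 0) (hb1 : u₀ 1 = 0) :
    ∀ x ∈ Icc (0:ℝ) 1,
      Summable (fun ν : KoopIdx => |phiIdx u₀ ν * aIdx ν x|) ∧
      (∑' ν : KoopIdx, phiIdx u₀ ν * aIdx ν x) = u₀ x := by
  intro x hx
  have hcont : ContinuousOn u₀ (Icc 0 1) := by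
    have h1 : ContinuousOn (fun y => ∫ s in (0:ℝ)..y, du s) (Icc 0 1) := by
      have := intervalIntegral.continuousOn_primitive_interval' (a := 0) hdu_int (by simp)
      rwa [uIcc_of_le (by norm_num)] at this
    refine h1.congr fun y hy => ?_
    rw [hAC y hy, hb0, zero_add]
  set u : ℝ → ℝ := IccExtend (zero_le_one (α := ℝ)) ((Icc (0:ℝ) 1).restrict u₀) with hu
  have huc : Continuous u := (continuousOn_iff_continuous_restrict.1 hcont).Icc_extend'
  have hueq : ∀ y ∈ Icc (0:ℝ) 1, u y = u₀ y := fun y hy => by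
    rw [hu, IccExtend_of_mem _ _ hy]; rfl
  have hprim : ∀ y ∈ Icc (0:ℝ) 1, ∫ s in (0:ℝ)..y, u s = ∫ s in (0:ℝ)..y, u₀ s := by
    intro y hy
    refine intervalIntegral.integral_congr fun s hs => ?_
    rw [uIcc_of_le hy.1] at hs
    exact hueq s ⟨hs.1, hs.2.trans hy.2⟩
  have hL2 : L2norm u = L2norm u₀ := by
    unfold L2norm
    congr 1
    refine intervalIntegral.integral_congr fun s hs => ?_
    rw [uIcc_of_le (by norm_num)] at hs
    simp only [hueq s hs]
  have hH : ∀ y ∈ Icc (0:ℝ) 1, coleHopfH u y = coleHopfH u₀ y := by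
    intro y hy
    unfold coleHopfH
    rw [hprim y hy]
    congr 1
    refine intervalIntegral.integral_congr fun s hs => ?_
    rw [uIcc_of_le (by norm_num)] at hs
    simp only [hprim s hs]
  have hl : ∀ n, lCoef n u = lCoef n u₀ := by
    intro n
    unfold lCoef cCoef
    congr 1
    refine intervalIntegral.integral_congr fun s hs => ?_
    rw [uIcc_of_le (by norm_num)] at hs
    simp only [hH s hs]
  have hphi : ∀ ν, phiIdx u ν = phiIdx u₀ ν := by
    intro ν
    unfold phiIdx
    simp only [hl]
  have hmain := aux_main u du huc (by rw [hL2]; exact h.2.2) hdu_int hdu_sq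
    (fun y hy => by rw [hueq y hy, hAC y hy, hb0, zero_add]) (by rw [hueq 1 (by simp), hb1]) x hx
  simp only [hphi, hueq x hx] at hmain
  exact hmain
end

section
/- (The φ_ν are Koopman eigenfunctionals with eigenvalues λ_ν.) Let u₀ ∈ Ω_B and t > 0, and let u(t,·) = −2 ∂ₓv(t,·)/v(t,·) be the Burgers evolution of u₀. Then for every ν ∈ 𝒜, φ_ν(u(t,·)) = e^{λ_ν t} φ_ν(u₀). -/
open MeasureTheory Real Set

lemma kh_summable_mul_exp (t : ℝ) (ht : 0 < t) :
    Summable (fun n : ℕ+ => ((n : ℕ) : ℝ) * Real.exp (-((n : ℕ) : ℝ) ^ 2 * π ^ 2 * t)) := by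
  have hr : 0 < π ^ 2 * t := by positivity
  have h1 := (Real.summable_pow_mul_exp_neg_nat_mul 1 hr).comp_injective PNat.coe_injective
  refine Summable.of_nonneg_of_le (fun n => by positivity) (fun n => ?_) h1
  have hn : (1 : ℝ) ≤ ((n : ℕ) : ℝ) := by exact_mod_cast n.pos
  simp only [Function.comp, pow_one]
  refine mul_le_mul_of_nonneg_left (Real.exp_le_exp.mpr ?_) (by positivity)
  nlinarith [mul_le_mul_of_nonneg_left hn hr.le, mul_nonneg hr.le (sub_nonneg.mpr hn),
    mul_nonneg (mul_nonneg hr.le (sub_nonneg.mpr hn)) (zero_le_one.trans hn)]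

lemma kh_summable_exp (t : ℝ) (ht : 0 < t) :
    Summable (fun n : ℕ+ => Real.exp (-((n : ℕ) : ℝ) ^ 2 * π ^ 2 * t)) := by
  refine Summable.of_nonneg_of_le (fun n => by positivity) (fun n => ?_) (kh_summable_mul_exp t ht)
  have hn : (1 : ℝ) ≤ ((n : ℕ) : ℝ) := by exact_mod_cast n.pos
  exact le_mul_of_one_le_left (Real.exp_pos _).le hn

lemma kh_cosKernel_pos (a t : ℝ) (ht : 0 < t) : 0 < HurwitzZeta.cosKernel (a : UnitAddCircle) t := by
  have hinv : 0 < 1 / t := by positivity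
  have h1 := HurwitzZeta.hasSum_int_evenKernel a hinv
  have h2 : 0 < HurwitzZeta.evenKernel (a : UnitAddCircle) (1 / t) := by
    rw [← h1.tsum_eq]
    exact h1.summable.tsum_pos (fun n => (Real.exp_pos _).le) 0 (Real.exp_pos _)
  rw [HurwitzZeta.evenKernel_functional_equation, one_div_one_div] at h2
  exact (pos_iff_pos_of_mul_pos h2).mp (by positivity)

lemma kh_theta_hasSum (z t : ℝ) (ht : 0 < t) :
    HasSum (fun n : ℕ+ => 2 * Real.cos (((n : ℕ) : ℝ) * π * z) *
      Real.exp (-((n : ℕ) : ℝ) ^ 2 * π ^ 2 * t))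
      (HurwitzZeta.cosKernel ((z / 2 : ℝ) : UnitAddCircle) (π * t) - 1) := by
  have h1 := HurwitzZeta.hasSum_nat_cosKernel₀ (z / 2) (t := π * t) (by positivity)
  rw [← Equiv.pnatEquivNat.hasSum_iff] at h1
  convert h1 using 1
  funext n
  have hn : ((Equiv.pnatEquivNat n : ℕ) : ℝ) + 1 = ((n : ℕ) : ℝ) := by
    have := PNat.natPred_add_one n
    exact_mod_cast this
  simp only [Function.comp, hn]
  congr 2
  · congr 1; ring
  · ring

/-- The Neumann heat kernel is positive. -/
lemma kh_kernel (x y t : ℝ) (ht : 0 < t) :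
    ∃ K : ℝ, 0 < K ∧ HasSum (fun n : ℕ+ => 2 * Real.exp (-((n : ℕ) : ℝ) ^ 2 * π ^ 2 * t) *
      Real.cos (((n : ℕ) : ℝ) * π * x) * Real.cos (((n : ℕ) : ℝ) * π * y)) (K - 1) := by
  have hp : 0 < π * t := by positivity
  refine ⟨(HurwitzZeta.cosKernel (((x - y) / 2 : ℝ) : UnitAddCircle) (π * t) +
    HurwitzZeta.cosKernel (((x + y) / 2 : ℝ) : UnitAddCircle) (π * t)) / 2, ?_, ?_⟩
  · have := kh_cosKernel_pos ((x - y) / 2) _ hp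
    have := kh_cosKernel_pos ((x + y) / 2) _ hp
    linarith
  · have h := ((kh_theta_hasSum (x - y) t ht).add (kh_theta_hasSum (x + y) t ht)).div_const 2
    have e1 : (fun n : ℕ+ => 2 * Real.exp (-((n : ℕ) : ℝ) ^ 2 * π ^ 2 * t) *
        Real.cos (((n : ℕ) : ℝ) * π * x) * Real.cos (((n : ℕ) : ℝ) * π * y)) =
        fun n : ℕ+ => (2 * Real.cos (((n : ℕ) : ℝ) * π * (x - y)) *
          Real.exp (-((n : ℕ) : ℝ) ^ 2 * π ^ 2 * t) + 2 * Real.cos (((n : ℕ) : ℝ) * π * (x + y)) *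
          Real.exp (-((n : ℕ) : ℝ) ^ 2 * π ^ 2 * t)) / 2 := by
      funext n
      rw [mul_sub, mul_add, Real.cos_sub, Real.cos_add]
      ring
    rw [e1, show ∀ A B : ℝ, (A + B) / 2 - 1 = (A - 1 + (B - 1)) / 2 from fun A B => by ring]
    exact h

lemma kh_swap (c : ℕ+ → ℝ) (hc : Summable c) (f : ℕ+ → ℝ → ℝ)
    (hf : ∀ n, ContinuousOn (f n) (Icc 0 1)) (hb : ∀ n, ∀ y ∈ Icc (0:ℝ) 1, |f n y| ≤ c n) :
    HasSum (fun n => ∫ y in (0:ℝ)..1, f n y) (∫ y in (0:ℝ)..1, ∑' n, f n y) := by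
  have hsub : uIoc (0:ℝ) 1 ⊆ Icc 0 1 := by
    rw [uIoc_of_le zero_le_one]; exact Ioc_subset_Icc_self
  refine intervalIntegral.hasSum_integral_of_dominated_convergence (fun n _ => c n) (fun n => ?_)
    (fun n => ?_) ?_ ?_ ?_
  · exact ((hf n).mono hsub).aestronglyMeasurable measurableSet_uIoc
  · exact Filter.Eventually.of_forall fun y hy => hb n y (hsub hy)
  · exact Filter.Eventually.of_forall fun y hy => hc
  · exact intervalIntegrable_const
  · exact Filter.Eventually.of_forall fun y hy =>
      (Summable.of_norm_bounded hc (fun n => hb n y (hsub hy))).hasSum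

lemma kh_coleHopf (u : ℝ → ℝ) (hu : IntervalIntegrable u volume 0 1) :
    ContinuousOn (coleHopfH u) (Icc 0 1) ∧ (∀ x, 0 < coleHopfH u x) ∧
      ∫ y in (0:ℝ)..1, coleHopfH u y = 1 := by
  have hc : ContinuousOn (fun x => Real.exp (-(1/2) * ∫ s in (0:ℝ)..x, u s)) (Icc 0 1) := by
    have := intervalIntegral.continuousOn_primitive_interval' hu (a := 0) left_mem_uIcc
    rw [uIcc_of_le zero_le_one] at this
    fun_prop
  have hpos : 0 < ∫ y in (0:ℝ)..1, Real.exp (-(1/2) * ∫ s in (0:ℝ)..y, u s) := by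
    refine intervalIntegral.intervalIntegral_pos_of_pos_on ?_ (fun x _ => Real.exp_pos _)
      zero_lt_one
    exact (hc.intervalIntegrable_of_Icc zero_le_one)
  refine ⟨hc.div_const _, fun x => div_pos (Real.exp_pos _) hpos, ?_⟩
  unfold coleHopfH
  rw [intervalIntegral.integral_div]
  exact div_self hpos.ne'

lemma kh_lCoef_bound (u : ℝ → ℝ) (hu : IntervalIntegrable u volume 0 1) (n : ℕ) :
    |lCoef n u| ≤ Real.sqrt 2 := by
  obtain ⟨hc, hpos, h1⟩ := kh_coleHopf u hu
  unfold lCoef cCoef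
  rw [abs_mul, abs_of_nonneg (Real.sqrt_nonneg 2)]
  refine mul_le_of_le_one_right (Real.sqrt_nonneg 2) ?_
  rw [← Real.norm_eq_abs]
  refine (intervalIntegral.norm_integral_le_of_norm_le zero_le_one ?_
    (hc.intervalIntegrable_of_Icc (μ := volume) zero_le_one)).trans h1.le
  refine Filter.Eventually.of_forall fun y _ => ?_
  rw [Real.norm_eq_abs, abs_mul, abs_of_pos (hpos y)]
  exact mul_le_of_le_one_right (hpos y).le (Real.abs_cos_le_one _)

lemma kh_heatV_pos (u : ℝ → ℝ) (hu : IntervalIntegrable u volume 0 1) (t : ℝ) (ht : 0 < t)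
    (x : ℝ) : 0 < heatV u t x := by
  obtain ⟨hc, hpos, h1⟩ := kh_coleHopf u hu
  have hs2 : Real.sqrt 2 * Real.sqrt 2 = 2 := Real.mul_self_sqrt (by norm_num)
  obtain ⟨B, hB⟩ := isCompact_Icc.exists_bound_of_continuousOn hc
  set w := coleHopfH u with hw
  set k : ℕ+ → ℝ → ℝ := fun n y => 2 * Real.exp (-((n : ℕ) : ℝ) ^ 2 * π ^ 2 * t) *
      Real.cos (((n : ℕ) : ℝ) * π * x) * Real.cos (((n : ℕ) : ℝ) * π * y) with hk
  have hkb : ∀ n y, |k n y| ≤ 2 * Real.exp (-((n : ℕ) : ℝ) ^ 2 * π ^ 2 * t) := by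
    intro n y
    simp only [hk, abs_mul]
    rw [abs_of_pos (Real.exp_pos _), abs_two]
    have hE := Real.exp_pos (-((n : ℕ) : ℝ) ^ 2 * π ^ 2 * t)
    rw [mul_assoc]
    exact mul_le_of_le_one_right (by positivity)
      (mul_le_one₀ (Real.abs_cos_le_one _) (abs_nonneg _) (Real.abs_cos_le_one _))
  have hsum := (kh_summable_exp t ht).mul_left 2
  have hkc : ∀ n, Continuous (k n) := fun n => by simp only [hk]; fun_prop
  have hKc : Continuous (fun y => ∑' n, k n y) := continuous_tsum hkc hsum hkb
  have hKpos : ∀ y, 0 < 1 + ∑' n, k n y := by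
    intro y
    obtain ⟨K, hK, hS⟩ := kh_kernel x y t ht
    have : ∑' n, k n y = K - 1 := hS.tsum_eq
    rw [this]; linarith
  have hsw := kh_swap (fun n => B * (2 * Real.exp (-((n : ℕ) : ℝ) ^ 2 * π ^ 2 * t)))
    (hsum.mul_left B) (fun n y => w y * k n y) (fun n => hc.mul (hkc n).continuousOn) (by
      intro n y hy
      rw [abs_mul]
      exact mul_le_mul (hB y hy) (hkb n y) (abs_nonneg _) ((norm_nonneg _).trans (hB y hy)))
  have hwi : IntervalIntegrable w volume 0 1 := hc.intervalIntegrable_of_Icc zero_le_one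
  have hwKi : IntervalIntegrable (fun y => w y * ∑' n, k n y) volume 0 1 :=
    (hc.mul hKc.continuousOn).intervalIntegrable_of_Icc zero_le_one
  have hrep : heatV u t x = ∫ y in (0:ℝ)..1, w y * (1 + ∑' n, k n y) := by
    simp only [mul_add, mul_one]
    rw [intervalIntegral.integral_add hwi hwKi, h1]
    simp only [tsum_mul_left] at hsw
    unfold heatV
    rw [← hsw.tsum_eq]
    congr 1
    refine tsum_congr fun n => ?_
    have : ∀ y, w y * k n y = (2 * Real.exp (-((n : ℕ) : ℝ) ^ 2 * π ^ 2 * t) *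
      Real.cos (((n : ℕ) : ℝ) * π * x)) * (w y * Real.cos (((n : ℕ) : ℝ) * π * y)) := by
      intro y; simp only [hk]; ring
    simp only [this]
    rw [intervalIntegral.integral_const_mul, lCoef, cCoef, ← hw]
    linear_combination (Real.exp (-((n : ℕ) : ℝ) ^ 2 * π ^ 2 * t) *
      Real.cos (((n : ℕ) : ℝ) * π * x) *
      ∫ s in (0:ℝ)..1, w s * Real.cos (((n : ℕ) : ℝ) * π * s)) * hs2
  rw [hrep]
  refine intervalIntegral.intervalIntegral_pos_of_pos_on ?_
    (fun y _ => mul_pos (hpos y) (hKpos y)) zero_lt_one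
  exact (hc.mul (continuous_const.add hKc).continuousOn).intervalIntegrable_of_Icc zero_le_one

lemma kh_coef_summable (u : ℝ → ℝ) (hu : IntervalIntegrable u volume 0 1) (t : ℝ) (ht : 0 < t) :
    Summable (fun n : ℕ+ => ((n : ℕ) : ℝ) *
      |Real.exp (-((n : ℕ) : ℝ) ^ 2 * π ^ 2 * t) * lCoef (n : ℕ) u|) := by
  refine Summable.of_nonneg_of_le (fun n => by positivity) (fun n => ?_)
    ((kh_summable_mul_exp t ht).mul_right (Real.sqrt 2))
  rw [abs_mul, abs_of_pos (Real.exp_pos _), ← mul_assoc]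
  exact mul_le_mul_of_nonneg_left (kh_lCoef_bound u hu n) (by positivity)

/-- Abstract cosine series facts. -/
lemma kh_series_deriv (a : ℕ+ → ℝ) (ha : Summable (fun n : ℕ+ => ((n : ℕ) : ℝ) * |a n|)) :
    (∀ x, HasDerivAt (fun x => 1 + ∑' n : ℕ+, a n * (Real.sqrt 2 * Real.cos (((n : ℕ) : ℝ) * π * x)))
      (-∑' n : ℕ+, a n * (Real.sqrt 2 * ((n : ℕ) : ℝ) * π * Real.sin (((n : ℕ) : ℝ) * π * x))) x) ∧
    Continuous (fun x => -∑' n : ℕ+, a n *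
      (Real.sqrt 2 * ((n : ℕ) : ℝ) * π * Real.sin (((n : ℕ) : ℝ) * π * x))) := by
  have hs := ha.mul_right (Real.sqrt 2 * π)
  have hb : ∀ (n : ℕ+) (x : ℝ), ‖a n * (Real.sqrt 2 * ((n : ℕ) : ℝ) * π *
      Real.sin (((n : ℕ) : ℝ) * π * x))‖ ≤ ((n : ℕ) : ℝ) * |a n| * (Real.sqrt 2 * π) := by
    intro n x
    rw [Real.norm_eq_abs, abs_mul, abs_mul,
      abs_of_nonneg (show 0 ≤ Real.sqrt 2 * ((n : ℕ) : ℝ) * π by positivity)]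
    calc _ ≤ |a n| * (Real.sqrt 2 * ((n : ℕ) : ℝ) * π * 1) := by
          gcongr; exact Real.abs_sin_le_one _
      _ = _ := by ring
  refine ⟨fun x => ?_, ?_⟩
  · rw [← tsum_neg]
    refine HasDerivAt.const_add 1 ?_
    refine hasDerivAt_tsum (u := fun n : ℕ+ => ((n : ℕ) : ℝ) * |a n| * (Real.sqrt 2 * π)) hs
      (g := fun (n : ℕ+) x => a n * (Real.sqrt 2 * Real.cos (((n : ℕ) : ℝ) * π * x)))
      (g' := fun (n : ℕ+) x => -(a n * (Real.sqrt 2 * ((n : ℕ) : ℝ) * π *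
        Real.sin (((n : ℕ) : ℝ) * π * x)))) (y₀ := 0) ?_ ?_ ?_ x
    · intro n y
      have h := (((hasDerivAt_id y).const_mul (((n : ℕ) : ℝ) * π)).cos.const_mul
        (Real.sqrt 2)).const_mul (a n)
      simp only [id] at h
      exact h.congr_deriv (by ring)
    · intro n y
      rw [norm_neg]; exact hb n y
    · refine Summable.of_norm_bounded (ha.mul_right (Real.sqrt 2)) fun n => ?_
      have hn : (1 : ℝ) ≤ ((n : ℕ) : ℝ) := by exact_mod_cast n.pos
      rw [mul_zero, Real.cos_zero, mul_one, Real.norm_eq_abs, abs_mul,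
        abs_of_nonneg (Real.sqrt_nonneg 2)]
      gcongr
      exact le_mul_of_one_le_left (abs_nonneg _) hn
  · exact (continuous_tsum (fun n => by fun_prop) hs hb).neg

lemma kh_int_cos (k : ℤ) (hk : k ≠ 0) : ∫ s in (0:ℝ)..1, Real.cos (k * π * s) = 0 := by
  have hk' : (k : ℝ) * π ≠ 0 := mul_ne_zero (by exact_mod_cast hk) Real.pi_ne_zero
  rw [intervalIntegral.integral_comp_mul_left (fun x => Real.cos x) hk']
  simp [Real.sin_int_mul_pi]

lemma kh_orth (n m : ℕ+) : ∫ s in (0:ℝ)..1, Real.cos (((n : ℕ) : ℝ) * π * s) *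
    Real.cos (((m : ℕ) : ℝ) * π * s) = if n = m then 1 / 2 else 0 := by
  have h : ∀ s : ℝ, Real.cos (((n : ℕ) : ℝ) * π * s) * Real.cos (((m : ℕ) : ℝ) * π * s) =
      (1 / 2) * (Real.cos ((((n : ℕ) : ℤ) - ((m : ℕ) : ℤ) : ℤ) * π * s) +
        Real.cos ((((n : ℕ) : ℤ) + ((m : ℕ) : ℤ) : ℤ) * π * s)) := by
    intro s
    push_cast
    rw [sub_mul, sub_mul, add_mul, add_mul, Real.cos_sub, Real.cos_add]
    ring
  simp only [h]
  rw [intervalIntegral.integral_const_mul, intervalIntegral.integral_add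
    (Continuous.intervalIntegrable (by fun_prop) _ _)
    (Continuous.intervalIntegrable (by fun_prop) _ _),
    kh_int_cos (((n : ℕ) : ℤ) + ((m : ℕ) : ℤ)) (by have := n.pos; have := m.pos; omega)]
  split_ifs with hnm
  · subst hnm; simp
  · rw [kh_int_cos _ (by
      intro h0; apply hnm; apply PNat.eq; omega)]
    simp

lemma kh_series_coef (a : ℕ+ → ℝ) (ha : Summable (fun n : ℕ+ => |a n|)) :
    (∫ s in (0:ℝ)..1, (1 + ∑' n : ℕ+, a n * (Real.sqrt 2 * Real.cos (((n : ℕ) : ℝ) * π * s))) = 1) ∧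
    ∀ m : ℕ+, cCoef m (fun s => 1 + ∑' n : ℕ+,
      a n * (Real.sqrt 2 * Real.cos (((n : ℕ) : ℝ) * π * s))) = a m := by
  have hs2 : Real.sqrt 2 * Real.sqrt 2 = 2 := Real.mul_self_sqrt (by norm_num)
  have hs := ha.mul_right (Real.sqrt 2)
  have hb : ∀ (n : ℕ+) (x : ℝ), |a n * (Real.sqrt 2 * Real.cos (((n : ℕ) : ℝ) * π * x))|
      ≤ |a n| * Real.sqrt 2 := by
    intro n x
    rw [abs_mul, abs_mul, abs_of_nonneg (Real.sqrt_nonneg 2)]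
    gcongr
    exact mul_le_of_le_one_right (Real.sqrt_nonneg 2) (Real.abs_cos_le_one _)
  have hint : ∀ n : ℕ+, ∫ s in (0:ℝ)..1, Real.cos (((n : ℕ) : ℝ) * π * s) = 0 := by
    intro n
    have := kh_int_cos (((n : ℕ) : ℤ)) (by have := n.pos; omega)
    exact_mod_cast this
  have hcont : Continuous (fun s => ∑' n : ℕ+,
      a n * (Real.sqrt 2 * Real.cos (((n : ℕ) : ℝ) * π * s))) :=
    continuous_tsum (fun n => by fun_prop) hs hb
  refine ⟨?_, fun m => ?_⟩
  · have hsw := kh_swap _ hs _ (fun n => Continuous.continuousOn (by fun_prop))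
      (fun n y _ => hb n y)
    rw [intervalIntegral.integral_add intervalIntegrable_const (hcont.intervalIntegrable _ _),
      ← hsw.tsum_eq]
    simp [intervalIntegral.integral_const_mul, hint]
  · have hsw := kh_swap _ hs (fun n y => a n * (Real.sqrt 2 * Real.cos (((n : ℕ) : ℝ) * π * y)) *
        Real.cos (((m : ℕ) : ℝ) * π * y)) (fun n => Continuous.continuousOn (by fun_prop))
      (fun n y _ => by
        rw [abs_mul]
        exact (mul_le_of_le_one_right (abs_nonneg _) (Real.abs_cos_le_one _)).trans (hb n y))
    unfold cCoef
    simp only [add_mul, one_mul]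
    have hcm : Continuous (fun s : ℝ => Real.cos (((m : ℕ) : ℝ) * π * s)) := by fun_prop
    have hi2 : IntervalIntegrable (fun s => (∑' n : ℕ+,
        a n * (Real.sqrt 2 * Real.cos (((n : ℕ) : ℝ) * π * s))) *
        Real.cos (((m : ℕ) : ℝ) * π * s)) volume 0 1 := (hcont.mul hcm).intervalIntegrable _ _
    rw [intervalIntegral.integral_add (hcm.intervalIntegrable _ _) hi2, hint]
    simp only [tsum_mul_right] at hsw
    rw [← hsw.tsum_eq]
    have h3 : ∀ n : ℕ+, ∫ y in (0:ℝ)..1, a n * (Real.sqrt 2 * Real.cos (((n : ℕ) : ℝ) * π * y)) *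
        Real.cos (((m : ℕ) : ℝ) * π * y) = if n = m then a m * Real.sqrt 2 / 2 else 0 := by
      intro n
      have : ∀ y, a n * (Real.sqrt 2 * Real.cos (((n : ℕ) : ℝ) * π * y)) *
        Real.cos (((m : ℕ) : ℝ) * π * y) = a n * Real.sqrt 2 *
          (Real.cos (((n : ℕ) : ℝ) * π * y) * Real.cos (((m : ℕ) : ℝ) * π * y)) := by
        intro y; ring
      simp only [this]
      rw [intervalIntegral.integral_const_mul, kh_orth]
      split_ifs with hnm
      · subst hnm; ring
      · simp
    simp only [h3]
    rw [tsum_ite_eq]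
    linear_combination (a m / 2) * hs2

lemma kh_lCoef_burgers (u : ℝ → ℝ) (hu : IntervalIntegrable u volume 0 1) (t : ℝ) (ht : 0 < t)
    (m : ℕ+) : lCoef (m : ℕ) (fun x => burgersU u t x) =
      Real.exp (-((m : ℕ) : ℝ) ^ 2 * π ^ 2 * t) * lCoef (m : ℕ) u := by
  have hsum := kh_coef_summable u hu t ht
  have hsum' : Summable (fun n : ℕ+ =>
      |Real.exp (-((n : ℕ) : ℝ) ^ 2 * π ^ 2 * t) * lCoef (n : ℕ) u|) := by
    refine Summable.of_nonneg_of_le (fun n => abs_nonneg _) (fun n => ?_) hsum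
    have hn : (1 : ℝ) ≤ ((n : ℕ) : ℝ) := by exact_mod_cast n.pos
    exact le_mul_of_one_le_left (abs_nonneg _) hn
  obtain ⟨hd, hxc⟩ := kh_series_deriv _ hsum
  obtain ⟨hi, hco⟩ := kh_series_coef _ hsum'
  have hd' : ∀ x, HasDerivAt (heatV u t) (heatVx u t x) x := hd
  have hxc' : Continuous (heatVx u t) := hxc
  have hi' : ∫ s in (0:ℝ)..1, heatV u t s = 1 := hi
  have hpos := kh_heatV_pos u hu t ht
  have hVc : Continuous (heatV u t) := continuous_iff_continuousAt.mpr fun x => (hd' x).continuousAt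
  have hprim : ∀ x, ∫ s in (0:ℝ)..x, burgersU u t s =
      -2 * Real.log (heatV u t x) - -2 * Real.log (heatV u t 0) := by
    intro x
    refine intervalIntegral.integral_eq_sub_of_hasDerivAt
      (f := fun x => -2 * Real.log (heatV u t x)) (fun y _ => ?_) ?_
    · have := ((hd' y).log (hpos y).ne').const_mul (-2)
      exact this.congr_deriv (by unfold burgersU; ring)
    · refine Continuous.intervalIntegrable ?_ _ _
      exact (continuous_const.mul hxc').div hVc fun y => (hpos y).ne'
  have hexp : ∀ x, Real.exp (-(1/2) * ∫ s in (0:ℝ)..x, burgersU u t s) =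
      heatV u t x / heatV u t 0 := by
    intro x
    rw [hprim, show -(1/2) * (-2 * Real.log (heatV u t x) - -2 * Real.log (heatV u t 0)) =
      Real.log (heatV u t x) - Real.log (heatV u t 0) by ring, Real.exp_sub,
      Real.exp_log (hpos x), Real.exp_log (hpos 0)]
  have hH : coleHopfH (fun x => burgersU u t x) = heatV u t := by
    funext x
    unfold coleHopfH
    simp only [hexp]
    rw [intervalIntegral.integral_div, hi']
    have := (hpos 0).ne'
    field_simp
  unfold lCoef
  rw [hH]
  exact hco m

/-- **The `φ_ν` are Koopman eigenfunctionals with eigenvalues `λ_ν`.** For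
`u₀ ∈ Ω_B` and `t > 0`, the Burgers evolution `u(t,·)` of `u₀` satisfies
`φ_ν(u(t,·)) = e^{λ_ν t} φ_ν(u₀)` for every `ν ∈ 𝒜`. -/
theorem phiIdx_koopman_eigenfunctional (u₀ : ℝ → ℝ) (h : MemOmegaB u₀) (t : ℝ) (ht : 0 < t) :
    ∀ ν : KoopIdx,
      phiIdx (fun x => burgersU u₀ t x) ν = Real.exp (lamIdx ν * t) * phiIdx u₀ ν := by
  intro ν
  have hl := kh_lCoef_burgers u₀ h.1 t ht
  obtain ⟨n, l⟩ := ν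
  have hlist : ∀ l : List ℕ+, (l.map (fun k => lCoef (k : ℕ) (fun x => burgersU u₀ t x))).prod =
      Real.exp (-π ^ 2 * (l.map (fun k => (((k : ℕ) : ℝ)) ^ 2)).sum * t) *
        (l.map (fun k => lCoef (k : ℕ) u₀)).prod := by
    intro l
    induction l with
    | nil => simp
    | cons k l ih =>
      simp only [bind_pure_comp, List.map_eq_map, List.map_cons, List.prod_cons,
        List.sum_cons] at ih ⊢
      rw [ih, hl, mul_add, add_mul, Real.exp_add,
        show -((k : ℕ) : ℝ) ^ 2 * π ^ 2 * t = -π ^ 2 * ((k : ℕ) : ℝ) ^ 2 * t by ring]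
      ring
  simp only [phiIdx, lamIdx]
  rw [hlist, hl, mul_add, add_mul, Real.exp_add,
    show -((n : ℕ) : ℝ) ^ 2 * π ^ 2 * t = -π ^ 2 * ((n : ℕ) : ℝ) ^ 2 * t by ring]
  ring
end

section
/- Let u₀ ∈ Ω_B. Then ‖∂ₓH(u₀)‖_{L²([0,1])} < 1/4, and consequently |H(u₀)(x) − 1| < 1/4 and H(u₀)(x) > 3/4 for every x ∈ [0,1]. -/
open MeasureTheory Real Set

lemma aux_l1_le (u : ℝ → ℝ) (h1 : IntervalIntegrable u volume 0 1)
    (h2 : IntervalIntegrable (fun s => u s ^ 2) volume 0 1) :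
    ∫ s in (0:ℝ)..1, |u s| ≤ L2norm u := by
  unfold L2norm
  apply Real.le_sqrt_of_sq_le
  set I := ∫ s in (0:ℝ)..1, |u s| with hI
  have h0 : 0 ≤ ∫ s in (0:ℝ)..1, (|u s| - I) ^ 2 :=
    intervalIntegral.integral_nonneg (by norm_num) (fun s _ => sq_nonneg _)
  have h3 : ∫ s in (0:ℝ)..1, (|u s| - I) ^ 2
      = ∫ s in (0:ℝ)..1, ((u s ^ 2 - (2 * I) * |u s|) + I ^ 2) := by
    congr 1
    ext s
    rw [← sq_abs (u s)]
    ring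
  rw [h3, intervalIntegral.integral_add (h2.sub (h1.abs.const_mul _)) (by simp),
    intervalIntegral.integral_sub h2 (h1.abs.const_mul _),
    intervalIntegral.integral_const_mul, ← hI] at h0
  simp at h0
  nlinarith

lemma aux_diff (u : ℝ → ℝ) (h1 : IntervalIntegrable u volume 0 1)
    (h2 : IntervalIntegrable (fun s => u s ^ 2) volume 0 1) (x y : ℝ)
    (hx : x ∈ Icc (0:ℝ) 1) (hy : y ∈ Icc (0:ℝ) 1) :
    |(∫ s in (0:ℝ)..x, u s) - ∫ s in (0:ℝ)..y, u s| ≤ L2norm u := by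
  have hz : ∀ z ∈ Icc (0:ℝ) 1, IntervalIntegrable u volume 0 z := fun z hz =>
    h1.mono_set (by
      rw [uIcc_of_le hz.1, uIcc_of_le zero_le_one]
      exact Icc_subset_Icc le_rfl hz.2)
  rw [intervalIntegral.integral_interval_sub_left (hz x hx) (hz y hy)]
  refine le_trans ?_ (aux_l1_le u h1 h2)
  rw [← Real.norm_eq_abs]
  refine le_trans intervalIntegral.norm_integral_le_integral_norm_uIoc ?_
  rw [intervalIntegral.integral_of_le zero_le_one]
  simp only [Real.norm_eq_abs]
  apply setIntegral_mono_set
  · exact ((intervalIntegrable_iff_integrableOn_Ioc_of_le zero_le_one).1 h1.abs)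
  · exact Filter.Eventually.of_forall (fun s => abs_nonneg _)
  · apply Filter.Eventually.of_forall
    intro s hs
    have hs : s ∈ Ioc (min y x) (max y x) := hs
    exact ⟨lt_of_le_of_lt (le_min hy.1 hx.1) hs.1, hs.2.trans (max_le hy.2 hx.2)⟩

lemma aux_bounds (u : ℝ → ℝ) (h1 : IntervalIntegrable u volume 0 1)
    (h2 : IntervalIntegrable (fun s => u s ^ 2) volume 0 1) (x : ℝ) (hx : x ∈ Icc (0:ℝ) 1) :
    Real.exp (-(L2norm u / 2)) ≤ coleHopfH u x ∧ coleHopfH u x ≤ Real.exp (L2norm u / 2) := by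
  have hc : ContinuousOn (fun y => Real.exp (-(1/2) * ∫ s in (0:ℝ)..y, u s)) (uIcc 0 1) := by
    have := intervalIntegral.continuousOn_primitive_interval' h1 (left_mem_uIcc)
    fun_prop
  have hi := hc.intervalIntegrable (μ := volume)
  unfold coleHopfH
  set E := Real.exp (-(1/2) * ∫ s in (0:ℝ)..x, u s) with hE
  have hEp : 0 < E := Real.exp_pos _
  set D := ∫ y in (0:ℝ)..1, Real.exp (-(1/2) * ∫ s in (0:ℝ)..y, u s) with hD
  have lo : E * Real.exp (-(L2norm u / 2)) ≤ D := by
    have := intervalIntegral.integral_mono_on (μ := volume) (a := (0:ℝ)) (b := 1) zero_le_one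
      (f := fun _ => E * Real.exp (-(L2norm u / 2))) (by simp) hi (fun y hy => by
        rw [hE, ← Real.exp_add]
        apply Real.exp_le_exp.2
        have := abs_le.1 (aux_diff u h1 h2 x y hx hy)
        linarith [this.1, this.2])
    rw [intervalIntegral.integral_const, sub_zero, one_smul] at this
    exact this
  have hi' : D ≤ E * Real.exp (L2norm u / 2) := by
    have := intervalIntegral.integral_mono_on (μ := volume) (a := (0:ℝ)) (b := 1) zero_le_one
      (g := fun _ => E * Real.exp (L2norm u / 2)) hi (by simp) (fun y hy => by
        rw [hE, ← Real.exp_add]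
        apply Real.exp_le_exp.2
        have := abs_le.1 (aux_diff u h1 h2 x y hx hy)
        linarith [this.1, this.2])
    rw [intervalIntegral.integral_const, sub_zero, one_smul] at this
    exact this
  have hDp : 0 < D := lt_of_lt_of_le (by positivity) lo
  have hm : Real.exp (-(L2norm u / 2)) * Real.exp (L2norm u / 2) = 1 := by
    rw [← Real.exp_add]; simp
  constructor
  · rw [le_div_iff₀ hDp]
    calc _ ≤ Real.exp (-(L2norm u / 2)) * (E * Real.exp (L2norm u / 2)) := by gcongr
      _ = E := by linear_combination E * hm
  · rw [div_le_iff₀ hDp]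
    calc E = Real.exp (L2norm u / 2) * (E * Real.exp (-(L2norm u / 2))) := by
          linear_combination -E * hm
      _ ≤ _ := by gcongr

/-- For `u₀ ∈ Ω_B`, the weak derivative `∂ₓH(u₀) = -(1/2) u₀ H(u₀)` has
`L²` norm less than `1/4`, and consequently `|H(u₀)(x) - 1| < 1/4` and `H(u₀)(x) > 3/4`
for every `x ∈ [0,1]`. -/
theorem coleHopfH_of_memOmegaB (u₀ : ℝ → ℝ) (h : MemOmegaB u₀) :
    L2norm (fun x => -(1/2) * u₀ x * coleHopfH u₀ x) < 1/4 ∧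
    ∀ x ∈ Icc (0:ℝ) 1, |coleHopfH u₀ x - 1| < 1/4 ∧ 3/4 < coleHopfH u₀ x := by
  obtain ⟨h1, h2, h3⟩ := h
  have hb := aux_bounds u₀ h1 h2
  have hN : 0 ≤ L2norm u₀ := Real.sqrt_nonneg _
  have hNs : L2norm u₀ ^ 2 = ∫ s in (0:ℝ)..1, u₀ s ^ 2 :=
    Real.sq_sqrt (intervalIntegral.integral_nonneg (by norm_num) (fun s _ => sq_nonneg _))
  set N := L2norm u₀ with hNdef
  have he : Real.exp (N / 2) ≤ Real.exp N := Real.exp_le_exp.2 (by linarith)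
  have he1 : 1 ≤ Real.exp N := Real.one_le_exp hN
  have hep := Real.exp_pos (N / 2)
  have hNe : N * Real.exp (N / 2) < 1 / 2 := by nlinarith
  have hN2 : N < 1 / 2 := by nlinarith
  constructor
  · have hle : ∫ s in (0:ℝ)..1, (-(1/2) * u₀ s * coleHopfH u₀ s) ^ 2
        ≤ (N * Real.exp (N / 2) / 2) ^ 2 := by
      have e : (N * Real.exp (N / 2) / 2) ^ 2
          = ∫ s in (0:ℝ)..1, (Real.exp (N / 2) / 2) ^ 2 * u₀ s ^ 2 := by
        rw [intervalIntegral.integral_const_mul, ← hNs]; ring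
      rw [e, intervalIntegral.integral_of_le zero_le_one,
        intervalIntegral.integral_of_le zero_le_one]
      apply integral_mono_of_nonneg
      · exact Filter.Eventually.of_forall (fun s => sq_nonneg _)
      · exact (intervalIntegrable_iff_integrableOn_Ioc_of_le zero_le_one).1 (h2.const_mul _)
      · refine (ae_restrict_iff' measurableSet_Ioc).2 (Filter.Eventually.of_forall ?_)
        intro s hs
        obtain ⟨ha, hb'⟩ := hb s ⟨hs.1.le, hs.2⟩
        have h0 : 0 ≤ coleHopfH u₀ s := (Real.exp_pos _).le.trans ha
        have : coleHopfH u₀ s ^ 2 ≤ Real.exp (N / 2) ^ 2 := by gcongr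
        have := mul_le_mul_of_nonneg_left this (sq_nonneg (u₀ s / 2))
        show (-(1/2) * u₀ s * coleHopfH u₀ s) ^ 2 ≤ (Real.exp (N / 2) / 2) ^ 2 * u₀ s ^ 2
        linarith
    unfold L2norm
    calc _ ≤ Real.sqrt ((N * Real.exp (N / 2) / 2) ^ 2) := Real.sqrt_le_sqrt hle
      _ = N * Real.exp (N / 2) / 2 := Real.sqrt_sq (by positivity)
      _ < 1 / 4 := by linarith
  · intro x hx
    obtain ⟨ha, hb'⟩ := hb x hx
    have hl := Real.add_one_le_exp (-(N / 2))
    have hm : Real.exp (-(N / 2)) * Real.exp (N / 2) = 1 := by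
      rw [← Real.exp_add]; simp
    have hu : Real.exp (N / 2) - 1 < 1 / 4 := by nlinarith
    refine ⟨abs_lt.2 ⟨by linarith, by linarith⟩, by linarith⟩
end
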